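/- arXiv:1706.03512 — 11 statements merged into one kernel-verified Lean document; each statement's English description precedes it below -/
import Mathlib

section
/- Let $\mathfrak{g}_0$ be a real Lie algebra and $\mathfrak{l}_0$ an $\mathbb{R}$-linear subspace of finite codimension that generates $\mathfrak{g}_0$ as a Lie algebra, with canonical descending chain $(F_h)_{h\in\mathbb{Z}}$. Then $\mathfrak{c}_0=\bigcap_{h\in\mathbb{Z}}F_h$ is the largest ideal of $\mathfrak{g}_0$ contained in $\mathfrak{l}_0$: it is an ideal of $\mathfrak{g}_0$ contained in $\mathfrak{l}_0$, and every ideal of $\mathfrak{g}_0$ contained in $\mathfrak{l}_0$ is contained in $\mathfrak{c}_0$. -/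
/-- The linear span of brackets `⁅x, y⁆` with `x ∈ A`, `y ∈ B`. -/
def bracketSpan {G : Type*} [LieRing G] [LieAlgebra ℝ G] (A B : Submodule ℝ G) :
    Submodule ℝ G :=
  Submodule.span ℝ {z : G | ∃ x ∈ A, ∃ y ∈ B, z = ⁅x, y⁆}

/-- `F` is the canonical descending chain associated to the pair `(𝔤₀, 𝔩₀)`:
`F (-1) = 𝔩₀`, `F h = F (h+1) + [F (h+1), F (-1)]` for `h < -1`, and
`F h = {X ∈ F (-1) ∣ [X, F (-1)] ⊆ F (h-1)}` for `h ≥ 0`. -/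
def IsCanonicalChain {G : Type*} [LieRing G] [LieAlgebra ℝ G]
    (l₀ : Submodule ℝ G) (F : ℤ → Submodule ℝ G) : Prop :=
  F (-1) = l₀ ∧
  (∀ h : ℤ, h < -1 → F h = F (h + 1) ⊔ bracketSpan (F (h + 1)) (F (-1))) ∧
  (∀ h : ℤ, 0 ≤ h → ∀ X : G, (X ∈ F h ↔ X ∈ F (-1) ∧ ∀ Y ∈ F (-1), ⁅X, Y⁆ ∈ F (h - 1)))

namespace IsCanonicalChain

variable {G : Type*} [LieRing G] [LieAlgebra ℝ G] {l₀ : Submodule ℝ G} {F : ℤ → Submodule ℝ G}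

theorem le_of_le_neg_one (hF : IsCanonicalChain l₀ F) {h : ℤ} (hh : h ≤ -1) : l₀ ≤ F h := by
  induction h, hh using Int.leInductionDown with
  | base => exact hF.1.ge
  | pred n hn ih =>
    rw [hF.2.1 (n - 1) (by omega), sub_add_cancel]
    exact ih.trans le_sup_left

theorem le_of_lie_mem (hF : IsCanonicalChain l₀ F) {a : Submodule ℝ G}
    (ha : ∀ x ∈ a, ∀ y ∈ l₀, ⁅x, y⁆ ∈ a) (hal : a ≤ l₀) (h : ℤ) : a ≤ F h := by
  rcases le_total h (-1) with hh | hh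
  · exact hal.trans (hF.le_of_le_neg_one hh)
  · induction h, hh using Int.leInduction with
    | base => exact hal.trans hF.1.ge
    | succ n hn ih =>
      intro x hx
      rw [hF.2.2 (n + 1) (by omega), add_sub_cancel_right, hF.1]
      exact ⟨hal hx, fun y hy => ih (ha x hx y hy)⟩

theorem lie_mem_iInf (hF : IsCanonicalChain l₀ F) {x y : G} (hx : x ∈ ⨅ h : ℤ, F h)
    (hy : y ∈ l₀) : ⁅x, y⁆ ∈ ⨅ h : ℤ, F h := by
  rw [Submodule.mem_iInf] at hx ⊢
  have key (h : ℤ) (hh : -1 ≤ h) : ⁅x, y⁆ ∈ F h := by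
    have := ((hF.2.2 (h + 1) (by omega) x).1 (hx _)).2 y (hF.1.ge hy)
    rwa [add_sub_cancel_right] at this
  intro h
  rcases le_total h (-1) with hh | hh
  · exact hF.le_of_le_neg_one hh (hF.1.le (key (-1) le_rfl))
  · exact key h hh

end IsCanonicalChain

/-- A subspace stable under bracketing with a generating set is an ideal. -/
theorem lie_mem_of_lieSpan_eq_top {R L : Type*} [CommRing R] [LieRing L] [LieAlgebra R L]
    {s : Set L} (hs : LieSubalgebra.lieSpan R L s = ⊤) {c : Submodule R L}
    (hc : ∀ y ∈ s, ∀ x ∈ c, ⁅y, x⁆ ∈ c) (y : L) : ∀ x ∈ c, ⁅y, x⁆ ∈ c := by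
  have hy : y ∈ LieSubalgebra.lieSpan R L s := hs ▸ LieSubalgebra.mem_top y
  induction hy using LieSubalgebra.lieSpan_induction with
  | mem y hy => exact hc y hy
  | zero => simp
  | add y z _ _ hy hz =>
    intro x hx
    rw [add_lie]
    exact c.add_mem (hy x hx) (hz x hx)
  | smul r y _ hy =>
    intro x hx
    rw [smul_lie]
    exact c.smul_mem r (hy x hx)
  | lie y z _ _ hy hz =>
    intro x hx
    rw [lie_lie]
    exact c.sub_mem (hy _ (hz x hx)) (hz _ (hy x hx))

theorem statement2 {G : Type*} [LieRing G] [LieAlgebra ℝ G]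
    (l₀ : Submodule ℝ G)
    (hcodim : FiniteDimensional ℝ (G ⧸ l₀))
    (hgen : LieSubalgebra.lieSpan ℝ G (l₀ : Set G) = ⊤)
    (F : ℤ → Submodule ℝ G) (hF : IsCanonicalChain l₀ F) :
    (∀ x ∈ (⨅ h : ℤ, F h), ∀ y : G, ⁅y, x⁆ ∈ (⨅ h : ℤ, F h)) ∧
    (⨅ h : ℤ, F h) ≤ l₀ ∧
    (∀ a : Submodule ℝ G, (∀ x ∈ a, ∀ y : G, ⁅y, x⁆ ∈ a) → a ≤ l₀ →
      a ≤ ⨅ h : ℤ, F h) := by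
  refine ⟨fun x hx y => lie_mem_of_lieSpan_eq_top hgen (fun z hz w hw => ?_) y x hx,
    (iInf_le F (-1)).trans hF.1.le,
    fun a ha hal => le_iInf (hF.le_of_lie_mem (fun x hx y _ => ?_) hal)⟩
  · rw [← lie_skew]
    exact neg_mem (hF.lie_mem_iInf hw hz)
  · rw [← lie_skew]
    exact neg_mem (ha x hx y)
end

section
/- Let $\mathfrak{g}_0$ be a real Lie algebra and $\mathfrak{l}_0$ an $\mathbb{R}$-linear subspace of finite codimension that generates $\mathfrak{g}_0$ as a Lie algebra, with canonical descending chain $(F_h)_{h\in\mathbb{Z}}$. Then the chain is a filtration of $\mathfrak{g}_0$: it is descending ($F_{h+1}\subseteq F_h$ for all $h\in\mathbb{Z}$) and satisfies $[F_{h_1},F_{h_2}]\subseteq F_{h_1+h_2}$ for all $h_1,h_2\in\mathbb{Z}$. -/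
namespace IsCanonicalChain

variable {G : Type*} [LieRing G] [LieAlgebra ℝ G] {l₀ : Submodule ℝ G} {F : ℤ → Submodule ℝ G}

theorem succ_le (hF : IsCanonicalChain l₀ F) (h : ℤ) : F (h + 1) ≤ F h := by
  obtain ⟨-, hneg, hnonneg⟩ := hF
  rcases lt_or_ge h (-1) with hh | hh
  · rw [hneg h hh]
    exact le_sup_left
  · induction h, hh using Int.leInduction with
    | base => exact fun X hX => ((hnonneg 0 le_rfl X).1 hX).1
    | succ n hn ih =>
      intro X hX
      obtain ⟨hX₁, hX₂⟩ := (hnonneg (n + 1 + 1) (by lia) X).1 hX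
      refine (hnonneg (n + 1) (by lia) X).2 ⟨hX₁, fun Y hY => ?_⟩
      have := hX₂ Y hY
      rw [add_sub_cancel_right] at this ⊢
      exact ih this

theorem antitone (hF : IsCanonicalChain l₀ F) : Antitone F :=
  antitone_int_of_succ_le hF.succ_le

theorem lie_mem_sub_one (hF : IsCanonicalChain l₀ F) {h : ℤ} {x y : G} (hx : x ∈ F h)
    (hy : y ∈ F (-1)) : ⁅x, y⁆ ∈ F (h - 1) := by
  rcases lt_or_ge h 0 with hh | hh
  · rw [hF.2.1 (h - 1) (by lia), sub_add_cancel]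
    exact Submodule.mem_sup_right (Submodule.subset_span ⟨x, hx, y, hy, rfl⟩)
  · exact ((hF.2.2 h hh x).1 hx).2 y hy

theorem lie_mem_add_of_neg (hF : IsCanonicalChain l₀ F) {k : ℤ} (hk : k ≤ -1) :
    ∀ (h : ℤ), ∀ x ∈ F h, ∀ y ∈ F k, ⁅x, y⁆ ∈ F (h + k) := by
  induction k, hk using Int.leInductionDown with
  | base => exact fun h x hx y hy => hF.lie_mem_sub_one hx hy
  | pred n hn ih =>
    intro h x hx y hy
    rw [hF.2.1 (n - 1) (by lia), sub_add_cancel] at hy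
    have hle : F n ⊔ bracketSpan (F n) (F (-1)) ≤
        (F (h + (n - 1))).comap (LieAlgebra.ad ℝ G x : G →ₗ[ℝ] G) := by
      refine sup_le (fun u hu => ?_) (Submodule.span_le.2 ?_)
      · exact hF.antitone (by lia) (ih h x hx u hu)
      · rintro _ ⟨u, hu, v, hv, rfl⟩
        change ⁅x, ⁅u, v⁆⁆ ∈ F (h + (n - 1))
        rw [leibniz_lie, ← lie_skew u ⁅x, v⁆]
        refine add_mem ?_ (neg_mem ?_)
        · rw [← add_sub_assoc]
          exact hF.lie_mem_sub_one (ih h x hx u hu) hv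
        · have := ih (h - 1) _ (hF.lie_mem_sub_one hx hv) u hu
          rwa [show h - 1 + n = h + (n - 1) by ring] at this
    exact hle hy

theorem lie_mem_add_of_nonneg (hF : IsCanonicalChain l₀ F) (n : ℕ) :
    ∀ h k : ℤ, 0 ≤ h → 0 ≤ k → h + k = n → ∀ x ∈ F h, ∀ y ∈ F k, ⁅x, y⁆ ∈ F (h + k) := by
  induction n using Nat.strong_induction_on with
  | _ n ih =>
    intro h k hh hk hn x hx y hy
    have hy' : y ∈ F (-1) := hF.antitone (by lia) hy
    refine (hF.2.2 (h + k) (by lia) _).2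
      ⟨hF.antitone (by lia) (hF.lie_mem_sub_one hx hy'), fun z hz => ?_⟩
    have hyz := hF.lie_mem_sub_one hy hz
    have hxz := hF.lie_mem_sub_one hx hz
    have key₁ : ⁅x, ⁅y, z⁆⁆ ∈ F (h + (k - 1)) := by
      rcases eq_or_lt_of_le hk with rfl | hk'
      · exact hF.lie_mem_add_of_neg (by lia) h x hx _ hyz
      · exact ih (n - 1) (by lia) h (k - 1) hh (by lia) (by lia) x hx _ hyz
    have key₂ : ⁅y, ⁅x, z⁆⁆ ∈ F (k + (h - 1)) := by
      rcases eq_or_lt_of_le hh with rfl | hh'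
      · exact hF.lie_mem_add_of_neg (by lia) k y hy _ hxz
      · exact ih (n - 1) (by lia) k (h - 1) hk (by lia) (by lia) y hy _ hxz
    rw [lie_lie]
    refine sub_mem ?_ ?_
    · rwa [← add_sub_assoc] at key₁
    · rwa [show k + (h - 1) = h + k - 1 by ring] at key₂

theorem lie_mem_add (hF : IsCanonicalChain l₀ F) {h k : ℤ} {x y : G} (hx : x ∈ F h)
    (hy : y ∈ F k) : ⁅x, y⁆ ∈ F (h + k) := by
  rcases lt_or_ge k 0 with hk | hk
  · exact hF.lie_mem_add_of_neg (by lia) h x hx y hy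
  rcases lt_or_ge h 0 with hh | hh
  · rw [← lie_skew, add_comm]
    exact neg_mem (hF.lie_mem_add_of_neg (by lia) k y hy x hx)
  · exact hF.lie_mem_add_of_nonneg (h + k).toNat h k hh hk (by lia) x hx y hy

end IsCanonicalChain

theorem statement3 {G : Type*} [LieRing G] [LieAlgebra ℝ G]
    (l₀ : Submodule ℝ G)
    (hcodim : FiniteDimensional ℝ (G ⧸ l₀))
    (hgen : LieSubalgebra.lieSpan ℝ G (l₀ : Set G) = ⊤)
    (F : ℤ → Submodule ℝ G) (hF : IsCanonicalChain l₀ F) :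
    (∀ h : ℤ, F (h + 1) ≤ F h) ∧
    (∀ h₁ h₂ : ℤ, ∀ x ∈ F h₁, ∀ y ∈ F h₂, ⁅x, y⁆ ∈ F (h₁ + h₂)) := by
  exact ⟨hF.succ_le, fun _ _ _ hx _ hy => hF.lie_mem_add hx hy⟩
end

section
/- Let $(\mathfrak{g}_0,\mathfrak{h}_0,\mathfrak{l}_0)$ be a contact triple with canonical descending chain $(F_h)_{h\in\mathbb{Z}}$, and let $k$ be a positive integer. Then $F_k\subseteq\mathfrak{h}_0$ if and only if for every $X\in\mathfrak{l}_0\setminus\mathfrak{h}_0$ there exist an integer $j$ with $0\le j\le k$ and elements $X_0,\dots,X_j\in\mathfrak{l}_0$ such that the iterated bracket $[X,X_0,\dots,X_j]\notin\mathfrak{l}_0$. -/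
/-- For `n ≥ 0`, the term `F (n - 1)` of the canonical chain consists of the elements all of whose
iterated brackets with at most `n` elements of `l₀` stay in `l₀`. -/
theorem IsCanonicalChain.mem_iff_foldl_mem {G : Type*} [LieRing G] [LieAlgebra ℝ G]
    {l₀ : Submodule ℝ G} {F : ℤ → Submodule ℝ G} (hF : IsCanonicalChain l₀ F) (n : ℕ) (X : G) :
    X ∈ F ((n : ℤ) - 1) ↔
      ∀ L : List G, L.length ≤ n → (∀ Y ∈ L, Y ∈ l₀) → L.foldl (fun a b => ⁅a, b⁆) X ∈ l₀ := by
  obtain ⟨hbase, -, hstep⟩ := hF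
  induction n generalizing X with
  | zero => simp [hbase]
  | succ n ih =>
    have hn : ((n + 1 : ℕ) : ℤ) - 1 = n := by push_cast; ring
    rw [hn, hstep n (Int.natCast_nonneg n), hbase]
    constructor
    · rintro ⟨hX, hXY⟩ L hL hmem
      cases L with
      | nil => exact hX
      | cons Y L =>
        exact (ih _).1 (hXY Y (hmem Y (by simp))) L (by simpa using hL)
          fun Z hZ => hmem Z (by simp [hZ])
    · intro h
      refine ⟨h [] (by simp) (by simp), fun Y hY => (ih _).2 fun L hL hmem => ?_⟩
      exact h (Y :: L) (by simpa using hL) (List.forall_mem_cons.2 ⟨hY, hmem⟩)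

theorem statement7 {G : Type*} [LieRing G] [LieAlgebra ℝ G]
    (l₀ : Submodule ℝ G)
    (hcodim : FiniteDimensional ℝ (G ⧸ l₀))
    (hgen : LieSubalgebra.lieSpan ℝ G (l₀ : Set G) = ⊤)
    (h₀ : LieSubalgebra ℝ G)
    (hcodim' : FiniteDimensional ℝ (G ⧸ h₀.toSubmodule))
    (hsub : h₀.toSubmodule ≤ l₀)
    (hbr : ∀ a ∈ h₀, ∀ x ∈ l₀, ⁅a, x⁆ ∈ l₀)
    (F : ℤ → Submodule ℝ G) (hF : IsCanonicalChain l₀ F)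
    (k : ℕ) (hk : 0 < k) :
    F (k : ℤ) ≤ h₀.toSubmodule ↔
      ∀ X ∈ l₀, X ∉ h₀.toSubmodule →
        ∃ j : ℕ, j ≤ k ∧ ∃ L : List G, L.length = j + 1 ∧ (∀ Y ∈ L, Y ∈ l₀) ∧
          L.foldl (fun a b => ⁅a, b⁆) X ∉ l₀ := by
  have hmem := hF.mem_iff_foldl_mem (k + 1)
  have hk' : ((k + 1 : ℕ) : ℤ) - 1 = k := by push_cast; ring
  rw [hk'] at hmem
  constructor
  · intro h X hX hXh
    have hXF : X ∉ F (k : ℤ) := fun hXF => hXh (h hXF)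
    rw [hmem] at hXF
    push Not at hXF
    obtain ⟨L, hL, hLmem, hLX⟩ := hXF
    cases L with
    | nil => exact absurd hX hLX
    | cons Y L => exact ⟨L.length, by simpa using hL, Y :: L, rfl, hLmem, hLX⟩
  · intro h X hX
    by_contra hXh
    rw [hmem] at hX
    obtain ⟨j, hj, L, hL, hLmem, hLX⟩ := h X (hX [] (by simp) (by simp)) hXh
    exact hLX (hX L (by omega) hLmem)
end

section
/- Let $\mathfrak{g}$ be a complex Lie algebra equipped with a conjugation $\sigma$ and $\mathfrak{q}$ a complex Lie subalgebra with $\bar{\mathfrak{q}}=\sigma(\mathfrak{q})$, with the associated chains $(\bar{\mathfrak{q}}^{(h)})_{h\ge 0}$ and $(\tilde{\mathfrak{q}}^{(h)})_{h\ge 0}$. Then $\bigcap_{h\ge 0}\bar{\mathfrak{q}}^{(h)}=\{Z\in\bar{\mathfrak{q}}\mid [Z,W_1,\dots,W_h]\in\mathfrak{q}+\bar{\mathfrak{q}}\text{ for all }h\ge 1\text{ and all }W_1,\dots,W_h\in\mathfrak{q}\}$. -/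
/-- `σ` is a conjugation of the complex Lie algebra `G`: an involutive conjugate-linear
map preserving brackets. -/
def IsConjugation {G : Type*} [LieRing G] [LieAlgebra ℂ G] (σ : G → G) : Prop :=
  (∀ x y : G, σ (x + y) = σ x + σ y) ∧
  (∀ (c : ℂ) (x : G), σ (c • x) = (starRingEnd ℂ) c • σ x) ∧
  (∀ x : G, σ (σ x) = x) ∧
  (∀ x y : G, σ ⁅x, y⁆ = ⁅σ x, σ y⁆)

/-- `Qb, Qt` are the chains `q̄⁽ʰ⁾` and `q̃⁽ʰ⁾` associated to the complex Lie
subalgebra `q` and the conjugation `σ`:  `q̄⁽⁰⁾ = σ(q)`, `q̃⁽ʰ⁾ = q + q̄⁽ʰ⁾`, and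
`q̄⁽ʰ⁺¹⁾ = {Z ∈ q̄⁽ʰ⁾ ∣ [Z, q] ⊆ q̃⁽ʰ⁾}`. -/
def IsCRChain {G : Type*} [LieRing G] [LieAlgebra ℂ G] (σ : G → G)
    (q : LieSubalgebra ℂ G) (Qb Qt : ℕ → Submodule ℂ G) : Prop :=
  ((Qb 0 : Submodule ℂ G) : Set G) = σ '' q ∧
  (∀ h : ℕ, Qt h = q.toSubmodule ⊔ Qb h) ∧
  (∀ h : ℕ, ∀ Z : G, (Z ∈ Qb (h + 1) ↔ Z ∈ Qb h ∧ ∀ W ∈ q, ⁅Z, W⁆ ∈ Qt h))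

namespace IsCRChain

variable {G : Type*} [LieRing G] [LieAlgebra ℂ G] {σ : G → G} {q : LieSubalgebra ℂ G}
  {Qb Qt : ℕ → Submodule ℂ G}

theorem antitone_left (hc : IsCRChain σ q Qb Qt) : Antitone Qb :=
  antitone_nat_of_succ_le fun h Z hZ => ((hc.2.2 h Z).1 hZ).1

theorem antitone_right (hc : IsCRChain σ q Qb Qt) : Antitone Qt := by
  intro h k hk
  rw [hc.2.1 h, hc.2.1 k]
  exact sup_le_sup_left (hc.antitone_left hk) _

/-- Membership in `Qb (h + 1)` only needs to be tested on `Qb 0`. -/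
theorem mem_left_succ_iff (hc : IsCRChain σ q Qb Qt) (h : ℕ) (Z : G) :
    Z ∈ Qb (h + 1) ↔ Z ∈ Qb 0 ∧ ∀ W ∈ q, ⁅Z, W⁆ ∈ Qt h := by
  refine ⟨fun hZ => ⟨hc.antitone_left (Nat.zero_le _) hZ, ((hc.2.2 h Z).1 hZ).2⟩, ?_⟩
  rintro ⟨hZ, hW⟩
  refine (hc.2.2 h Z).2 ⟨?_, hW⟩
  induction h with
  | zero => exact hZ
  | succ h ih =>
    have hW' : ∀ W ∈ q, ⁅Z, W⁆ ∈ Qt h := fun W hq =>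
      hc.antitone_right (Nat.le_succ h) (hW W hq)
    exact (hc.2.2 h Z).2 ⟨ih hW', hW'⟩

theorem mem_right_of_mem (hc : IsCRChain σ q Qb Qt) (h : ℕ) {A : G} (hA : A ∈ q) :
    A ∈ Qt h := by
  rw [hc.2.1 h]
  exact Submodule.mem_sup_left hA

theorem mem_right_succ_iff (hc : IsCRChain σ q Qb Qt) (h : ℕ) (X : G) :
    X ∈ Qt (h + 1) ↔ X ∈ Qt 0 ∧ ∀ W ∈ q, ⁅X, W⁆ ∈ Qt h := by
  constructor
  · intro hX
    refine ⟨hc.antitone_right (Nat.zero_le _) hX, fun W hW => ?_⟩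
    rw [hc.2.1 (h + 1)] at hX
    obtain ⟨A, hA, B, hB, rfl⟩ := Submodule.mem_sup.1 hX
    rw [add_lie]
    exact add_mem (hc.mem_right_of_mem h (q.lie_mem hA hW)) (((hc.2.2 h B).1 hB).2 W hW)
  · rintro ⟨hX, hW⟩
    rw [hc.2.1 0] at hX
    obtain ⟨A, hA, B, hB, rfl⟩ := Submodule.mem_sup.1 hX
    rw [hc.2.1 (h + 1)]
    refine Submodule.add_mem_sup hA ((hc.mem_left_succ_iff h B).2 ⟨hB, fun W hq => ?_⟩)
    have := hW W hq
    rw [add_lie] at this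
    exact (Submodule.add_mem_iff_right _ (hc.mem_right_of_mem h (q.lie_mem hA hq))).1 this

/-- `Qt h` consists of the elements whose iterated brackets of length at most `h` with
elements of `q` lie in `Qt 0`. -/
theorem mem_right_iff (hc : IsCRChain σ q Qb Qt) (h : ℕ) (X : G) :
    X ∈ Qt h ↔ ∀ L : List G, L.length ≤ h → (∀ W ∈ L, W ∈ q) →
      L.foldl (fun a b => ⁅a, b⁆) X ∈ Qt 0 := by
  induction h generalizing X with
  | zero => simp
  | succ h ih =>
    rw [hc.mem_right_succ_iff]
    constructor
    · rintro ⟨hX, hW⟩ (_ | ⟨W, L⟩) hl hL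
      · exact hX
      · exact (ih _).1 (hW W (hL W (by simp))) L (by simpa using hl)
          fun V hV => hL V (by simp [hV])
    · intro H
      refine ⟨H [] (by simp) (by simp), fun W hW => (ih _).2 fun L hl hL => ?_⟩
      exact H (W :: L) (by simpa using hl) (by simpa [hW] using hL)

end IsCRChain

theorem statement8 {G : Type*} [LieRing G] [LieAlgebra ℂ G]
    (σ : G → G) (hσ : IsConjugation σ)
    (q : LieSubalgebra ℂ G) (Qb Qt : ℕ → Submodule ℂ G)
    (hc : IsCRChain σ q Qb Qt) :
    (((⨅ h : ℕ, Qb h) : Submodule ℂ G) : Set G) =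
      {Z : G | Z ∈ Qb 0 ∧ ∀ L : List G, L ≠ [] → (∀ W ∈ L, W ∈ q) →
        L.foldl (fun a b => ⁅a, b⁆) Z ∈ Qt 0} := by
  ext Z
  simp only [SetLike.mem_coe, Submodule.mem_iInf, Set.mem_ofPred_eq]
  constructor
  · intro hZ
    refine ⟨hZ 0, ?_⟩
    rintro (_ | ⟨W, L⟩) hne hL
    · exact absurd rfl hne
    · exact (hc.mem_right_iff L.length _).1
        (((hc.mem_left_succ_iff L.length Z).1 (hZ _)).2 W (hL W (by simp))) L le_rfl
        fun V hV => hL V (by simp [hV])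
  · rintro ⟨hZ, H⟩ (_ | h)
    · exact hZ
    · refine (hc.mem_left_succ_iff h Z).2 ⟨hZ, fun W hW => (hc.mem_right_iff h _).2 ?_⟩
      intro L _ hL
      exact H (W :: L) (by simp) (by simpa [hW] using hL)
end

section
/- Let $\mathfrak{g}$ be a complex Lie algebra equipped with a conjugation $\sigma$ and $\mathfrak{q}$ a complex Lie subalgebra with $\bar{\mathfrak{q}}=\sigma(\mathfrak{q})$, with the associated chain $(\bar{\mathfrak{q}}^{(h)})_{h\ge 0}$. Then for every $h\ge 0$, the complex subspace $\bar{\mathfrak{q}}^{(h)}$ is a complex Lie subalgebra of $\mathfrak{g}$. -/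
theorem statement9 {G : Type*} [LieRing G] [LieAlgebra ℂ G]
    (σ : G → G) (hσ : IsConjugation σ)
    (q : LieSubalgebra ℂ G) (Qb Qt : ℕ → Submodule ℂ G)
    (hc : IsCRChain σ q Qb Qt) :
    ∀ h : ℕ, ∀ Z₁ ∈ Qb h, ∀ Z₂ ∈ Qb h, ⁅Z₁, Z₂⁆ ∈ Qb h := by
  obtain ⟨h0, ht, hs⟩ := hc
  have bracket_mem_Qt : ∀ h : ℕ, (∀ Z₁ ∈ Qb h, ∀ Z₂ ∈ Qb h, ⁅Z₁, Z₂⁆ ∈ Qb h) →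
      ∀ Z ∈ Qb (h + 1), ∀ X ∈ Qt h, ⁅Z, X⁆ ∈ Qt h := by
    intro h ih Z hZ X hX
    obtain ⟨hZh, hZq⟩ := (hs h Z).1 hZ
    rw [ht, Submodule.mem_sup] at hX
    obtain ⟨a, ha, b, hb, rfl⟩ := hX
    rw [lie_add]
    refine (Qt h).add_mem (hZq a ha) ?_
    rw [ht]
    exact Submodule.mem_sup_right (ih Z hZh b hb)
  intro h
  induction h with
  | zero =>
    intro Z₁ h₁ Z₂ h₂
    rw [← SetLike.mem_coe, h0] at h₁ h₂ ⊢
    obtain ⟨a, ha, rfl⟩ := h₁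
    obtain ⟨b, hb, rfl⟩ := h₂
    exact ⟨⁅a, b⁆, q.lie_mem ha hb, hσ.2.2.2 a b⟩
  | succ h ih =>
    intro Z₁ h₁ Z₂ h₂
    obtain ⟨h₁', hq₁⟩ := (hs h Z₁).1 h₁
    obtain ⟨h₂', hq₂⟩ := (hs h Z₂).1 h₂
    refine (hs h _).2 ⟨ih Z₁ h₁' Z₂ h₂', fun W hW => ?_⟩
    rw [lie_lie]
    exact (Qt h).sub_mem (bracket_mem_Qt h ih Z₁ h₁ _ (hq₂ W hW))
      (bracket_mem_Qt h ih Z₂ h₂ _ (hq₁ W hW))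
end

section
/- Let $\mathfrak{g}$ be a complex Lie algebra equipped with a conjugation $\sigma$ and $\mathfrak{q}$ a complex Lie subalgebra with $\bar{\mathfrak{q}}=\sigma(\mathfrak{q})$, with the associated chains $(\bar{\mathfrak{q}}^{(h)})_{h\ge 0}$ and $(\tilde{\mathfrak{q}}^{(h)})_{h\ge 0}$. Then $\mathfrak{q}'=\mathfrak{q}+\bigcap_{h\ge 0}\bar{\mathfrak{q}}^{(h)}$ satisfies: (a) $\mathfrak{q}'=\bigcap_{h\ge 0}\tilde{\mathfrak{q}}^{(h)}$; (b) $\mathfrak{q}'$ is a complex Lie subalgebra of $\mathfrak{g}$ with $\mathfrak{q}\subseteq\mathfrak{q}'\subseteq\mathfrak{q}+\bar{\mathfrak{q}}$; and (c) $\mathfrak{q}'$ is the largest such subalgebra, i.e., every complex Lie subalgebra $\mathfrak{l}$ with $\mathfrak{q}\subseteq\mathfrak{l}\subseteq\mathfrak{q}+\bar{\mathfrak{q}}$ satisfies $\mathfrak{l}\subseteq\mathfrak{q}'$. -/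
namespace IsCRChain

variable {G : Type*} [LieRing G] [LieAlgebra ℂ G] {σ : G → G}
  {q : LieSubalgebra ℂ G} {Qb Qt : ℕ → Submodule ℂ G}

/-- Every Lie subalgebra between `q` and `q + q̄` meets `q̄` inside each term of the chain. -/
theorem mem_of_mem_lieSubalgebra (hc : IsCRChain σ q Qb Qt) {l : LieSubalgebra ℂ G}
    (hql : q.toSubmodule ≤ l.toSubmodule) (hl : l.toSubmodule ≤ Qt 0) (h : ℕ) :
    ∀ Z ∈ l, Z ∈ Qb 0 → Z ∈ Qb h := by
  obtain ⟨-, hQt, hQb⟩ := hc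
  induction h with
  | zero => exact fun _ _ hZ => hZ
  | succ h ih =>
    intro Z hZl hZ
    refine (hQb h Z).2 ⟨ih Z hZl hZ, fun W hW => ?_⟩
    have hZW : ⁅Z, W⁆ ∈ l := l.lie_mem hZl (hql hW)
    have hZW0 : ⁅Z, W⁆ ∈ Qt 0 := hl hZW
    rw [hQt] at hZW0
    obtain ⟨w, hw, z, hz, hwz⟩ := Submodule.mem_sup.1 hZW0
    have hzl : z ∈ l := by
      rw [eq_sub_of_add_eq' hwz]
      exact l.sub_mem hZW (hql hw)
    rw [hQt, ← hwz]
    exact Submodule.add_mem_sup hw (ih z hzl hz)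

/-- Each term `q̄⁽ʰ⁾` of the chain is closed under the bracket. -/
theorem lie_mem (hc : IsCRChain σ q Qb Qt) (hσ : IsConjugation σ) (h : ℕ) :
    ∀ x ∈ Qb h, ∀ y ∈ Qb h, ⁅x, y⁆ ∈ Qb h := by
  obtain ⟨h0, hQt, hQb⟩ := hc
  induction h with
  | zero =>
    intro x hx y hy
    rw [← SetLike.mem_coe, h0] at hx hy ⊢
    obtain ⟨a, ha, rfl⟩ := hx
    obtain ⟨b, hb, rfl⟩ := hy
    exact ⟨⁅a, b⁆, q.lie_mem ha hb, hσ.2.2.2 a b⟩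
  | succ h ih =>
    have key : ∀ x ∈ Qb (h + 1), ∀ v ∈ Qt h, ⁅x, v⁆ ∈ Qt h := by
      intro x hx v hv
      obtain ⟨hxh, hxq⟩ := (hQb h x).1 hx
      rw [hQt] at hv
      obtain ⟨w, hw, z, hz, rfl⟩ := Submodule.mem_sup.1 hv
      rw [lie_add]
      refine add_mem (hxq w hw) ?_
      rw [hQt]
      exact Submodule.mem_sup_right (ih x hxh z hz)
    intro x hx y hy
    have hx' := (hQb h x).1 hx
    have hy' := (hQb h y).1 hy
    refine (hQb h _).2 ⟨ih x hx'.1 y hy'.1, fun W hW => ?_⟩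
    rw [lie_lie]
    exact sub_mem (key x hx _ (hy'.2 W hW)) (key y hy _ (hx'.2 W hW))

/-- A Lie subalgebra between `q` and `q + q̄` is contained in `q + ⋂ q̄⁽ʰ⁾`. -/
theorem lieSubalgebra_le (hc : IsCRChain σ q Qb Qt) {l : LieSubalgebra ℂ G}
    (hql : q.toSubmodule ≤ l.toSubmodule) (hl : l.toSubmodule ≤ Qt 0) :
    l.toSubmodule ≤ q.toSubmodule ⊔ ⨅ h : ℕ, Qb h := by
  intro x hx
  have hx0 := hl hx
  rw [hc.2.1] at hx0
  obtain ⟨w, hw, z, hz, rfl⟩ := Submodule.mem_sup.1 hx0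
  refine Submodule.add_mem_sup hw ((Submodule.mem_iInf _).2 fun h =>
    hc.mem_of_mem_lieSubalgebra hql hl h z ?_ hz)
  exact (Submodule.add_mem_iff_right _ (hql hw)).1 hx

/-- The sum of `q` and the intersection of the `q̄⁽ʰ⁾` is the intersection of the `q̃⁽ʰ⁾`. -/
theorem sup_iInf_eq (hc : IsCRChain σ q Qb Qt) :
    q.toSubmodule ⊔ ⨅ h : ℕ, Qb h = ⨅ h : ℕ, Qt h := by
  have hQt := hc.2.1
  apply le_antisymm
  · refine le_iInf fun h => ?_
    rw [hQt]
    exact sup_le_sup_left (iInf_le _ h) _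
  · have anti : Antitone Qb := antitone_nat_of_succ_le fun h Z hZ => ((hc.2.2 h Z).1 hZ).1
    have hq0 : q.toSubmodule ≤ Qt 0 := by
      rw [hQt]
      exact le_sup_left
    intro x hx
    rw [Submodule.mem_iInf] at hx
    have hx0 := hx 0
    rw [hQt] at hx0
    obtain ⟨w, hw, z, hz, rfl⟩ := Submodule.mem_sup.1 hx0
    refine Submodule.add_mem_sup hw ((Submodule.mem_iInf _).2 fun h => ?_)
    have hxh := hx h
    rw [hQt] at hxh
    obtain ⟨w', hw', z', hz', heq⟩ := Submodule.mem_sup.1 hxh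
    have hdiff : z - z' = w' - w := by
      rw [sub_eq_sub_iff_add_eq_add, add_comm z w, heq]
    have hmem : z - z' ∈ Qb h := by
      refine hc.mem_of_mem_lieSubalgebra le_rfl hq0 h _ ?_
        (sub_mem hz (anti (Nat.zero_le h) hz'))
      rw [hdiff]
      exact q.sub_mem hw' hw
    simpa using add_mem hmem hz'

/-- The sum of `q` and the intersection of the `q̄⁽ʰ⁾` is closed under the bracket. -/
theorem lie_mem_sup_iInf (hc : IsCRChain σ q Qb Qt) (hσ : IsConjugation σ) :
    ∀ x ∈ q.toSubmodule ⊔ ⨅ h : ℕ, Qb h, ∀ y ∈ q.toSubmodule ⊔ ⨅ h : ℕ, Qb h,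
      ⁅x, y⁆ ∈ q.toSubmodule ⊔ ⨅ h : ℕ, Qb h := by
  have key : ∀ z ∈ ⨅ h : ℕ, Qb h, ∀ w ∈ q, ⁅z, w⁆ ∈ q.toSubmodule ⊔ ⨅ h : ℕ, Qb h := by
    intro z hz w hw
    rw [hc.sup_iInf_eq, Submodule.mem_iInf]
    exact fun h => ((hc.2.2 h z).1 ((Submodule.mem_iInf _).1 hz (h + 1))).2 w hw
  intro x hx y hy
  obtain ⟨w, hw, z, hz, rfl⟩ := Submodule.mem_sup.1 hx
  obtain ⟨w', hw', z', hz', rfl⟩ := Submodule.mem_sup.1 hy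
  rw [add_lie, lie_add, lie_add]
  refine add_mem (add_mem (Submodule.mem_sup_left (q.lie_mem hw hw')) ?_)
    (add_mem (key z hz w' hw') (Submodule.mem_sup_right ?_))
  · rw [← lie_skew]
    exact neg_mem (key z' hz' w hw)
  · rw [Submodule.mem_iInf] at hz hz' ⊢
    exact fun h => hc.lie_mem hσ h z (hz h) z' (hz' h)

end IsCRChain

theorem statement10 {G : Type*} [LieRing G] [LieAlgebra ℂ G]
    (σ : G → G) (hσ : IsConjugation σ)
    (q : LieSubalgebra ℂ G) (Qb Qt : ℕ → Submodule ℂ G)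
    (hc : IsCRChain σ q Qb Qt) :
    let q' : Submodule ℂ G := q.toSubmodule ⊔ ⨅ h : ℕ, Qb h
    -- (a)
    (q' = ⨅ h : ℕ, Qt h) ∧
    -- (b)
    (∀ x ∈ q', ∀ y ∈ q', ⁅x, y⁆ ∈ q') ∧
    q.toSubmodule ≤ q' ∧ q' ≤ Qt 0 ∧
    -- (c)
    (∀ l : LieSubalgebra ℂ G, q.toSubmodule ≤ l.toSubmodule →
      l.toSubmodule ≤ Qt 0 → l.toSubmodule ≤ q') := by
  intro q'
  refine ⟨hc.sup_iInf_eq, hc.lie_mem_sup_iInf hσ, le_sup_left, ?_,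
    fun l hql hl => hc.lieSubalgebra_le hql hl⟩
  exact hc.sup_iInf_eq.trans_le (iInf_le _ 0)
end

section
/- Let $\mathfrak{g}$ be a complex Lie algebra equipped with a conjugation $\sigma$ and $\mathfrak{q}$ a complex Lie subalgebra with $\bar{\mathfrak{q}}=\sigma(\mathfrak{q})$, with the associated chains $(\bar{\mathfrak{q}}^{(h)})_{h\ge 0}$ and $(\tilde{\mathfrak{q}}^{(h)})_{h\ge 0}$. Then the following are equivalent: (1) there is no complex Lie subalgebra $\mathfrak{q}'$ of $\mathfrak{g}$ with $\mathfrak{q}\subsetneq\mathfrak{q}'\subseteq\mathfrak{q}+\bar{\mathfrak{q}}$ (weak nondegeneracy); (2) $\bigcap_{h\ge 0}\bar{\mathfrak{q}}^{(h)}=\mathfrak{q}\cap\bar{\mathfrak{q}}$; (3) $\bigcap_{h\ge 0}\tilde{\mathfrak{q}}^{(h)}=\mathfrak{q}$. -/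
namespace IsCRChain

variable {G : Type*} [LieRing G] [LieAlgebra ℂ G] {σ : G → G}
  {q : LieSubalgebra ℂ G} {Qb Qt : ℕ → Submodule ℂ G}

theorem mem_tilde (hc : IsCRChain σ q Qb Qt) {h : ℕ} {x : G} :
    x ∈ Qt h ↔ ∃ w ∈ q, ∃ z ∈ Qb h, w + z = x := by
  rw [hc.2.1 h, Submodule.mem_sup]
  rfl

theorem le_tilde (hc : IsCRChain σ q Qb Qt) (h : ℕ) : q.toSubmodule ≤ Qt h := by
  rw [hc.2.1 h]
  exact le_sup_left

theorem bar_le_tilde (hc : IsCRChain σ q Qb Qt) (h : ℕ) : Qb h ≤ Qt h := by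
  rw [hc.2.1 h]
  exact le_sup_right

theorem lie_mem_bar (hσ : IsConjugation σ) (hc : IsCRChain σ q Qb Qt) (h : ℕ) :
    ∀ x ∈ Qb h, ∀ y ∈ Qb h, ⁅x, y⁆ ∈ Qb h := by
  induction h with
  | zero =>
    intro x hx y hy
    rw [← SetLike.mem_coe, hc.1] at hx hy ⊢
    obtain ⟨a, ha, rfl⟩ := hx
    obtain ⟨b, hb, rfl⟩ := hy
    exact ⟨⁅a, b⁆, q.lie_mem ha hb, hσ.2.2.2 a b⟩
  | succ h ih =>
    have key : ∀ x ∈ Qb (h + 1), ∀ v ∈ Qt h, ⁅x, v⁆ ∈ Qt h := by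
      intro x hx v hv
      obtain ⟨hx₀, hxq⟩ := (hc.2.2 h x).1 hx
      obtain ⟨w, hw, z, hz, rfl⟩ := hc.mem_tilde.1 hv
      rw [lie_add]
      exact add_mem (hxq w hw) (hc.bar_le_tilde h (ih x hx₀ z hz))
    intro x hx y hy
    have hx' := (hc.2.2 h x).1 hx
    have hy' := (hc.2.2 h y).1 hy
    refine (hc.2.2 h _).2 ⟨ih x hx'.1 y hy'.1, fun w hw => ?_⟩
    rw [lie_lie]
    exact sub_mem (key x hx _ (hy'.2 w hw)) (key y hy _ (hx'.2 w hw))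

/-- A subalgebra between `q` and `q + q̄` meets `q̄` inside every term of the chain. -/
theorem inf_le_bar (hc : IsCRChain σ q Qb Qt) {q' : LieSubalgebra ℂ G} (hq : q ≤ q')
    (hq' : q'.toSubmodule ≤ Qt 0) (h : ℕ) : q'.toSubmodule ⊓ Qb 0 ≤ Qb h := by
  induction h with
  | zero => exact inf_le_right
  | succ h ih =>
    intro z hz
    refine (hc.2.2 h z).2 ⟨ih hz, fun w hw => ?_⟩
    have hzw : ⁅z, w⁆ ∈ q' := q'.lie_mem hz.1 (hq hw)
    obtain ⟨a, ha, b, hb, hab⟩ := hc.mem_tilde.1 (hq' hzw)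
    have hbq : b ∈ q' := by
      rw [← add_sub_cancel_left a b, hab]
      exact sub_mem hzw (hq ha)
    exact hc.mem_tilde.2 ⟨a, ha, b, ih ⟨hbq, hb⟩, hab⟩

theorem le_iInf_tilde (hc : IsCRChain σ q Qb Qt) {q' : LieSubalgebra ℂ G} (hq : q ≤ q')
    (hq' : q'.toSubmodule ≤ Qt 0) : q'.toSubmodule ≤ ⨅ h, Qt h := by
  refine le_iInf fun h x hx => ?_
  obtain ⟨a, ha, b, hb, rfl⟩ := hc.mem_tilde.1 (hq' hx)
  have hbq : b ∈ q' := by simpa using sub_mem (show a + b ∈ q' from hx) (hq ha)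
  exact hc.mem_tilde.2 ⟨a, ha, b, hc.inf_le_bar hq hq' h ⟨hbq, hb⟩, rfl⟩

theorem inf_le_iInf_bar (hc : IsCRChain σ q Qb Qt) :
    q.toSubmodule ⊓ Qb 0 ≤ ⨅ h, Qb h :=
  le_iInf (hc.inf_le_bar le_rfl (hc.le_tilde 0))

theorem bar_le_zero (hc : IsCRChain σ q Qb Qt) (h : ℕ) : Qb h ≤ Qb 0 := by
  induction h with
  | zero => exact le_rfl
  | succ h ih => exact fun z hz => ih ((hc.2.2 h z).1 hz).1

theorem iInf_tilde (hc : IsCRChain σ q Qb Qt) :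
    ⨅ h, Qt h = q.toSubmodule ⊔ ⨅ h, Qb h := by
  refine le_antisymm (fun x hx => ?_) (sup_le (le_iInf hc.le_tilde) (iInf_mono hc.bar_le_tilde))
  rw [Submodule.mem_iInf] at hx
  obtain ⟨a, ha, b, hb, rfl⟩ := hc.mem_tilde.1 (hx 0)
  refine Submodule.add_mem_sup ha ((Submodule.mem_iInf _).2 fun h => ?_)
  obtain ⟨c, hcq, d, hd, hcd⟩ := hc.mem_tilde.1 (hx h)
  have e : b - d = c - a := by
    rw [sub_eq_sub_iff_add_eq_add, add_comm b a, hcd]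
  have hbd : b - d ∈ Qb h := by
    refine hc.inf_le_bar le_rfl (hc.le_tilde 0) h ⟨?_, sub_mem hb (hc.bar_le_zero h hd)⟩
    rw [e]
    exact sub_mem (show c ∈ q.toSubmodule from hcq) ha
  simpa using add_mem hbd hd

theorem lie_mem_iInf_tilde (hσ : IsConjugation σ) (hc : IsCRChain σ q Qb Qt) {x y : G}
    (hx : x ∈ ⨅ h, Qt h) (hy : y ∈ ⨅ h, Qt h) : ⁅x, y⁆ ∈ ⨅ h, Qt h := by
  have bq : ∀ b ∈ ⨅ h, Qb h, ∀ w ∈ q, ⁅b, w⁆ ∈ ⨅ h, Qt h := fun b hb w hw =>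
    (Submodule.mem_iInf _).2 fun h =>
      ((hc.2.2 h b).1 ((Submodule.mem_iInf _).1 hb (h + 1))).2 w hw
  have bb : ∀ b ∈ ⨅ h, Qb h, ∀ d ∈ ⨅ h, Qb h, ⁅b, d⁆ ∈ ⨅ h, Qt h := fun b hb d hd =>
    (Submodule.mem_iInf _).2 fun h => hc.bar_le_tilde h <|
      hc.lie_mem_bar hσ h b ((Submodule.mem_iInf _).1 hb h) d ((Submodule.mem_iInf _).1 hd h)
  rw [hc.iInf_tilde, Submodule.mem_sup] at hx hy
  obtain ⟨a, ha, b, hb, rfl⟩ := hx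
  obtain ⟨c, hcq, d, hd, rfl⟩ := hy
  rw [add_lie, lie_add, lie_add]
  refine add_mem (add_mem ?_ ?_) (add_mem (bq b hb c hcq) (bb b hb d hd))
  · exact le_iInf hc.le_tilde (show ⁅a, c⁆ ∈ q.toSubmodule from q.lie_mem ha hcq)
  · rw [← lie_skew]
    exact neg_mem (bq d hd a ha)

theorem iInf_bar_eq_iff (hc : IsCRChain σ q Qb Qt) :
    (⨅ h, Qb h) = q.toSubmodule ⊓ Qb 0 ↔ (⨅ h, Qt h) = q.toSubmodule := by
  rw [hc.iInf_tilde, sup_eq_left]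
  exact ⟨fun e => e.le.trans inf_le_left,
    fun le => le_antisymm (le_inf le (iInf_le _ 0)) hc.inf_le_iInf_bar⟩

theorem weaklyNondegenerate_iff (hσ : IsConjugation σ) (hc : IsCRChain σ q Qb Qt) :
    (¬ ∃ q' : LieSubalgebra ℂ G, q < q' ∧ q'.toSubmodule ≤ Qt 0) ↔
      (⨅ h, Qt h) = q.toSubmodule := by
  constructor
  · intro hn
    by_contra hne
    refine hn ⟨{ (⨅ h, Qt h) with lie_mem' := hc.lie_mem_iInf_tilde hσ }, ?_, iInf_le _ 0⟩
    refine lt_of_le_of_ne (fun x hx => le_iInf hc.le_tilde hx) fun e => hne ?_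
    exact (congrArg LieSubalgebra.toSubmodule e).symm
  · rintro e ⟨q', hlt, hle⟩
    exact hlt.not_ge ((hc.le_iInf_tilde hlt.le hle).trans e.le)

end IsCRChain

theorem statement11 {G : Type*} [LieRing G] [LieAlgebra ℂ G]
    (σ : G → G) (hσ : IsConjugation σ)
    (q : LieSubalgebra ℂ G) (Qb Qt : ℕ → Submodule ℂ G)
    (hc : IsCRChain σ q Qb Qt) :
    ((¬ ∃ q' : LieSubalgebra ℂ G, q < q' ∧ q'.toSubmodule ≤ Qt 0) ↔
      (⨅ h : ℕ, Qb h) = q.toSubmodule ⊓ Qb 0) ∧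
    ((⨅ h : ℕ, Qb h) = q.toSubmodule ⊓ Qb 0 ↔ (⨅ h : ℕ, Qt h) = q.toSubmodule) := by
  exact ⟨(hc.weaklyNondegenerate_iff hσ).trans hc.iInf_bar_eq_iff.symm, hc.iInf_bar_eq_iff⟩
end

section
/- Let $\mathfrak{g}=\bigoplus_{h\in\mathbb{Z}}\mathfrak{g}_h$ be a $\mathbb{Z}$-graded real Lie algebra, and let $\eta\in\mathfrak{g}$ satisfy $[\eta,\mathfrak{g}_h]=0$ for all $h\le -2$. Then for every $k\ge 2$, the $k$-multilinear map $(\xi_1,\dots,\xi_k)\mapsto[\eta,\xi_1,\dots,\xi_k]$ on $\mathfrak{g}_{-1}$ is symmetric, i.e., $[\eta,\xi_{\tau(1)},\dots,\xi_{\tau(k)}]=[\eta,\xi_1,\dots,\xi_k]$ for every permutation $\tau$ of $\{1,\dots,k\}$ and all $\xi_1,\dots,\xi_k\in\mathfrak{g}_{-1}$. -/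
/-- If `η` annihilates every component of degree at most `-2`, then so does `⁅η, a⁆` for `a` of
degree `-1`. -/
theorem lie_lie_eq_zero_of_annihilates {G : Type*} [LieRing G] [LieAlgebra ℝ G]
    {g : ℤ → Submodule ℝ G}
    (hgrad : ∀ i j : ℤ, ∀ x ∈ g i, ∀ y ∈ g j, ⁅x, y⁆ ∈ g (i + j))
    {η : G} (hη : ∀ h : ℤ, h ≤ -2 → ∀ x ∈ g h, ⁅η, x⁆ = 0) {a : G} (ha : a ∈ g (-1)) :
    ∀ h : ℤ, h ≤ -2 → ∀ x ∈ g h, ⁅⁅η, a⁆, x⁆ = 0 := by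
  intro h hh x hx
  rw [lie_lie, hη h hh x hx, hη (-1 + h) (by lia) _ (hgrad _ _ a ha x hx), lie_zero, sub_zero]

/-- Iterated brackets of `η` with elements of degree `-1` are invariant under permuting these
elements, provided `η` annihilates every component of degree at most `-2`. -/
theorem List.Perm.foldl_lie_eq {G : Type*} [LieRing G] [LieAlgebra ℝ G]
    {g : ℤ → Submodule ℝ G}
    (hgrad : ∀ i j : ℤ, ∀ x ∈ g i, ∀ y ∈ g j, ⁅x, y⁆ ∈ g (i + j))
    {l₁ l₂ : List G} (hl : l₁.Perm l₂) (hmem : ∀ x ∈ l₁, x ∈ g (-1))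
    {η : G} (hη : ∀ h : ℤ, h ≤ -2 → ∀ x ∈ g h, ⁅η, x⁆ = 0) :
    l₁.foldl (fun a b => ⁅a, b⁆) η = l₂.foldl (fun a b => ⁅a, b⁆) η := by
  induction hl generalizing η with
  | nil => rfl
  | cons a _ ih =>
    rw [List.forall_mem_cons] at hmem
    exact ih hmem.2 (lie_lie_eq_zero_of_annihilates hgrad hη hmem.1)
  | swap a b l =>
    have hb : b ∈ g (-1) := hmem b (by simp)
    have ha : a ∈ g (-1) := hmem a (by simp)
    have hswap : ⁅⁅η, b⁆, a⁆ = ⁅⁅η, a⁆, b⁆ := by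
      have h := leibniz_lie η b a
      rw [hη (-1 + -1) (by norm_num) _ (hgrad _ _ b hb a ha), ← lie_skew b ⁅η, a⁆] at h
      exact add_neg_eq_zero.mp h.symm
    simp only [List.foldl_cons, hswap]
  | trans h₁ _ ih₁ ih₂ =>
    exact (ih₁ hmem hη).trans (ih₂ (fun x hx => hmem x (h₁.mem_iff.mpr hx)) hη)

theorem statement14 {G : Type*} [LieRing G] [LieAlgebra ℝ G]
    (g : ℤ → Submodule ℝ G)
    (hdecomp : DirectSum.IsInternal g)
    (hgrad : ∀ i j : ℤ, ∀ x ∈ g i, ∀ y ∈ g j, ⁅x, y⁆ ∈ g (i + j))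
    (η : G) (hη : ∀ h : ℤ, h ≤ -2 → ∀ x ∈ g h, ⁅η, x⁆ = 0) :
    ∀ k : ℕ, 2 ≤ k → ∀ ξ : Fin k → G, (∀ i, ξ i ∈ g (-1)) →
      ∀ τ : Equiv.Perm (Fin k),
        (List.ofFn (ξ ∘ τ)).foldl (fun a b => ⁅a, b⁆) η =
          (List.ofFn ξ).foldl (fun a b => ⁅a, b⁆) η := by
  intro k _ ξ hξ τ
  refine (Equiv.Perm.ofFn_comp_perm τ ξ).foldl_lie_eq hgrad ?_ hη
  intro x hx
  obtain ⟨i, rfl⟩ := (List.mem_ofFn' _ _).mp hx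
  exact hξ (τ i)
end

section
/- Let $\mathfrak{g}_0$ be a real Lie algebra with complexification $\mathfrak{g}=\mathbb{C}\otimes_{\mathbb{R}}\mathfrak{g}_0$, conjugation given by $\overline{X+iY}=X-iY$ for $X,Y\in\mathfrak{g}_0$, and let $\mathfrak{q}$ be a complex Lie subalgebra of $\mathfrak{g}$. Set $\tilde{\mathfrak{q}}_0=(\mathfrak{q}+\bar{\mathfrak{q}})\cap\mathfrak{g}_0$ and $F_0=\{X\in\tilde{\mathfrak{q}}_0\mid [X,\tilde{\mathfrak{q}}_0]\subseteq\tilde{\mathfrak{q}}_0\}$. If $X,Y\in\mathfrak{g}_0$, $X\in F_0$, and $X+iY\in\mathfrak{q}$, then $Y\in F_0$. (This shows that the complex structure $J$ on $\tilde{\mathfrak{q}}_0/F_0$, defined by $J(X\bmod F_0)=Y\bmod F_0$ whenever $X+iY\in\mathfrak{q}$, is well defined.) -/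
open TensorProduct

/-- The conjugation `X + iY ↦ X - iY` on the complexification `ℂ ⊗[ℝ] G₀`. -/
noncomputable def conjCpx (G₀ : Type*) [LieRing G₀] [LieAlgebra ℝ G₀] :
    ℂ ⊗[ℝ] G₀ →ₗ[ℝ] ℂ ⊗[ℝ] G₀ :=
  TensorProduct.map Complex.conjAe.toLinearMap LinearMap.id

/-- The canonical embedding `G₀ → ℂ ⊗[ℝ] G₀`, `X ↦ 1 ⊗ X`. -/
noncomputable def toCpx {G₀ : Type*} [LieRing G₀] [LieAlgebra ℝ G₀] (X : G₀) :
    ℂ ⊗[ℝ] G₀ :=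
  (1 : ℂ) ⊗ₜ[ℝ] X

/-- `q̃₀ = (q + q̄) ∩ 𝔤₀`: the real points of `q + q̄`. -/
noncomputable def realPts {G₀ : Type*} [LieRing G₀] [LieAlgebra ℝ G₀]
    (q : LieSubalgebra ℂ (ℂ ⊗[ℝ] G₀)) : Set G₀ :=
  {X : G₀ | ∃ a ∈ q, ∃ b ∈ q, toCpx X = a + conjCpx G₀ b}

/-- `F₀ = {X ∈ q̃₀ ∣ [X, q̃₀] ⊆ q̃₀}`. -/
noncomputable def stabPts {G₀ : Type*} [LieRing G₀] [LieAlgebra ℝ G₀]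
    (q : LieSubalgebra ℂ (ℂ ⊗[ℝ] G₀)) : Set G₀ :=
  {X : G₀ | X ∈ realPts q ∧ ∀ Z ∈ realPts q, ⁅X, Z⁆ ∈ realPts q}

section

variable {G₀ : Type*} [LieRing G₀] [LieAlgebra ℝ G₀]

theorem toCpx_add_I_smul (X Y : G₀) :
    toCpx X + Complex.I • toCpx Y = (1 : ℂ) ⊗ₜ[ℝ] X + Complex.I ⊗ₜ[ℝ] Y := by
  simp [toCpx, TensorProduct.smul_tmul']

theorem exists_eq_toCpx_add_I_smul (t : ℂ ⊗[ℝ] G₀) :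
    ∃ X Y : G₀, t = toCpx X + Complex.I • toCpx Y := by
  induction t using TensorProduct.induction_on with
  | zero => exact ⟨0, 0, by simp [toCpx]⟩
  | tmul z X =>
    refine ⟨z.re • X, z.im • X, ?_⟩
    rw [toCpx_add_I_smul, ← TensorProduct.smul_tmul, ← TensorProduct.smul_tmul,
      ← TensorProduct.add_tmul]
    congr 1
    apply Complex.ext <;> simp
  | add s t hs ht =>
    obtain ⟨X, Y, rfl⟩ := hs
    obtain ⟨X', Y', rfl⟩ := ht
    refine ⟨X + X', Y + Y', ?_⟩
    simp only [toCpx_add_I_smul, TensorProduct.tmul_add]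
    abel

theorem conjCpx_tmul (z : ℂ) (X : G₀) :
    conjCpx G₀ (z ⊗ₜ[ℝ] X) = (starRingEnd ℂ z) ⊗ₜ[ℝ] X := by
  simp [conjCpx]

theorem conjCpx_conjCpx (t : ℂ ⊗[ℝ] G₀) : conjCpx G₀ (conjCpx G₀ t) = t := by
  induction t using TensorProduct.induction_on with
  | zero => simp
  | tmul z X => simp [conjCpx_tmul]
  | add s t hs ht => simp [hs, ht]

/-- The real points of `q + q̄` are the real parts of the elements of `q`. -/
theorem mem_realPts_iff {q : LieSubalgebra ℂ (ℂ ⊗[ℝ] G₀)} {Z : G₀} :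
    Z ∈ realPts q ↔ ∃ W : G₀, toCpx Z + Complex.I • toCpx W ∈ q := by
  constructor
  · rintro ⟨a, ha, b, hb, h⟩
    have hc := congrArg (conjCpx G₀) h
    rw [map_add, conjCpx_conjCpx, toCpx, conjCpx_tmul, map_one] at hc
    obtain ⟨P, Q, hPQ⟩ := exists_eq_toCpx_add_I_smul (a + b)
    have hPQ' : conjCpx G₀ a + conjCpx G₀ b = toCpx P - Complex.I • toCpx Q := by
      rw [← map_add, hPQ, toCpx_add_I_smul, map_add, conjCpx_tmul, conjCpx_tmul]
      simp [toCpx, TensorProduct.smul_tmul', TensorProduct.neg_tmul, sub_eq_add_neg]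
    have h2 : (2 : ℂ) • toCpx Z = (2 : ℂ) • toCpx P := by
      calc (2 : ℂ) • toCpx Z = toCpx Z + toCpx Z := two_smul _ _
        _ = (a + conjCpx G₀ b) + (conjCpx G₀ a + b) := congrArg₂ (· + ·) h hc
        _ = (a + b) + (conjCpx G₀ a + conjCpx G₀ b) := by abel
        _ = (2 : ℂ) • toCpx P := by rw [hPQ, hPQ', two_smul]; abel
    have h3 : toCpx Z = toCpx P := smul_right_injective _ (two_ne_zero (α := ℂ)) h2
    exact ⟨Q, by rw [h3, ← hPQ]; exact q.add_mem ha hb⟩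
  · rintro ⟨W, hW⟩
    have hc := q.smul_mem (1 / 2 : ℂ) hW
    refine ⟨_, hc, _, hc, ?_⟩
    rw [toCpx_add_I_smul, smul_add, TensorProduct.smul_tmul', TensorProduct.smul_tmul', map_add,
      conjCpx_tmul, conjCpx_tmul, add_add_add_comm, ← TensorProduct.add_tmul,
      ← TensorProduct.add_tmul]
    have h1 : (1 / 2 : ℂ) • (1 : ℂ) + starRingEnd ℂ ((1 / 2 : ℂ) • (1 : ℂ)) = 1 := by
      apply Complex.ext <;> norm_num
    have h2 : (1 / 2 : ℂ) • Complex.I + starRingEnd ℂ ((1 / 2 : ℂ) • Complex.I) = 0 := by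
      apply Complex.ext <;> norm_num
    rw [h1, h2, TensorProduct.zero_tmul, add_zero, toCpx]

theorem imaginary_part_mem_realPts {q : LieSubalgebra ℂ (ℂ ⊗[ℝ] G₀)} {X Y : G₀}
    (h : toCpx X + Complex.I • toCpx Y ∈ q) : Y ∈ realPts q := by
  refine mem_realPts_iff.2 ⟨-X, ?_⟩
  convert q.smul_mem (-Complex.I) h using 1
  rw [smul_add, smul_smul]
  simp [toCpx, TensorProduct.tmul_neg, add_comm]

theorem sub_mem_realPts {q : LieSubalgebra ℂ (ℂ ⊗[ℝ] G₀)} {X Y : G₀}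
    (hX : X ∈ realPts q) (hY : Y ∈ realPts q) : X - Y ∈ realPts q := by
  obtain ⟨a, ha, b, hb, h⟩ := hX
  obtain ⟨c, hc, d, hd, h'⟩ := hY
  refine ⟨a - c, q.sub_mem ha hc, b - d, q.sub_mem hb hd, ?_⟩
  rw [map_sub, sub_add_sub_comm, ← h, ← h', toCpx, TensorProduct.tmul_sub]
  rfl

theorem lie_toCpx_add_I_smul (X Y Z W : G₀) :
    ⁅toCpx X + Complex.I • toCpx Y, toCpx Z + Complex.I • toCpx W⁆ =
      toCpx (⁅X, Z⁆ - ⁅Y, W⁆) + Complex.I • toCpx (⁅X, W⁆ + ⁅Y, Z⁆) := by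
  simp only [toCpx_add_I_smul, add_lie, lie_add, LieAlgebra.ExtendScalars.bracket_tmul,
    TensorProduct.tmul_add, TensorProduct.tmul_sub, mul_one, one_mul, Complex.I_mul_I,
    TensorProduct.neg_tmul]
  abel

end

theorem statement15 {G₀ : Type*} [LieRing G₀] [LieAlgebra ℝ G₀]
    (q : LieSubalgebra ℂ (ℂ ⊗[ℝ] G₀)) :
    ∀ X Y : G₀, X ∈ stabPts q →
      toCpx X + Complex.I • toCpx Y ∈ q → Y ∈ stabPts q := by
  intro X Y hX hXY
  refine ⟨imaginary_part_mem_realPts hXY, fun Z hZ => ?_⟩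
  obtain ⟨W, hW⟩ := mem_realPts_iff.1 hZ
  have h := q.lie_mem hXY hW
  rw [lie_toCpx_add_I_smul] at h
  simpa using sub_mem_realPts (imaginary_part_mem_realPts h)
    (hX.2 W (imaginary_part_mem_realPts hW))
end

section
/- For every nonnegative integer $k$, the $2k+4$ polynomials $(t-i)^{k+h+2}$ and $(t+i)^{k+h+2}$, for $0\le h\le k+1$, are linearly independent over $\mathbb{C}$, and hence form a basis of the $(2k+4)$-dimensional complex vector space of polynomials in $\mathbb{C}[t]$ of degree at most $2k+3$. -/
open Polynomial

noncomputable def polyFam (k : ℕ) : Fin (k + 2) ⊕ Fin (k + 2) → Polynomial ℂ :=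
  Sum.elim
    (fun h : Fin (k + 2) => (X - C Complex.I) ^ (k + (h : ℕ) + 2))
    (fun h : Fin (k + 2) => (X + C Complex.I) ^ (k + (h : ℕ) + 2))

theorem degree_sum_C_mul_X_sub_C_pow_lt {K : Type*} [Field K] (a : K) {n : ℕ} (c : Fin n → K) :
    (∑ h, C (c h) * (X - C a) ^ (h : ℕ)).degree < (n : WithBot ℕ) := by
  rw [← mem_degreeLT]
  refine Submodule.sum_mem _ fun h _ => ?_
  rw [← smul_eq_C_mul]
  refine Submodule.smul_mem _ _ (mem_degreeLT.2 ?_)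
  rw [degree_pow, degree_X_sub_C, nsmul_one]
  exact_mod_cast h.2

theorem eq_zero_of_sum_C_mul_X_sub_C_pow_eq_zero {K : Type*} [Field K] (a : K) {n : ℕ}
    (c : Fin n → K) (hc : ∑ h, C (c h) * (X - C a) ^ (h : ℕ) = 0) (h : Fin n) : c h = 0 := by
  have hX : ∑ h, C (c h) * (X : K[X]) ^ (h : ℕ) = 0 := by
    calc ∑ h, C (c h) * (X : K[X]) ^ (h : ℕ)
        = (∑ h, C (c h) * (X - C a) ^ (h : ℕ)).comp (X + C a) := by
          rw [Polynomial.sum_comp]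
          refine Finset.sum_congr rfl fun h _ => ?_
          rw [mul_comp, C_comp, pow_comp, sub_comp, X_comp, C_comp, add_sub_cancel_right]
      _ = 0 := by rw [hc, zero_comp]
  simpa [finsetSum_coeff, coeff_X_pow, Fin.val_inj] using congrArg (fun p => p.coeff h) hX

theorem eq_zero_of_X_sub_C_pow_mul_add_eq_zero {K : Type*} [Field K] {a b : K} (hab : a ≠ b)
    {n : ℕ} {A B : K[X]} (hB : B.degree < (n : WithBot ℕ))
    (h : (X - C a) ^ n * A + (X - C b) ^ n * B = 0) : B = 0 := by
  have hco : IsCoprime ((X - C a) ^ n) ((X - C b) ^ n) :=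
    (isCoprime_X_sub_C_of_isUnit_sub (sub_ne_zero.2 hab).isUnit).pow
  have hdvd : (X - C a) ^ n ∣ B :=
    hco.dvd_of_dvd_mul_left ⟨-A, by linear_combination h⟩
  refine eq_zero_of_dvd_of_degree_lt hdvd ?_
  rwa [degree_pow, degree_X_sub_C, nsmul_one]

theorem linearIndependent_X_sub_C_pow_sumElim {K : Type*} [Field K] {a b : K} (hab : a ≠ b)
    (n : ℕ) :
    LinearIndependent K (Sum.elim (fun h : Fin n => (X - C a) ^ (n + (h : ℕ)))
      (fun h : Fin n => (X - C b) ^ (n + (h : ℕ)))) := by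
  rw [Fintype.linearIndependent_iff]
  intro g hg
  have hsum : (X - C a) ^ n * ∑ h : Fin n, C (g (.inl h)) * (X - C a) ^ (h : ℕ) +
      (X - C b) ^ n * ∑ h : Fin n, C (g (.inr h)) * (X - C b) ^ (h : ℕ) = 0 := by
    rw [← hg, Fintype.sum_sum_type, Finset.mul_sum, Finset.mul_sum]
    simp only [Sum.elim_inl, Sum.elim_inr, smul_eq_C_mul, pow_add, mul_left_comm]
  have hB := eq_zero_of_X_sub_C_pow_mul_add_eq_zero hab
    (degree_sum_C_mul_X_sub_C_pow_lt b _) hsum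
  have hA := eq_zero_of_X_sub_C_pow_mul_add_eq_zero hab.symm
    (degree_sum_C_mul_X_sub_C_pow_lt a _) (by rwa [add_comm] at hsum)
  rintro (h | h)
  · exact eq_zero_of_sum_C_mul_X_sub_C_pow_eq_zero a (fun h => g (.inl h)) hA h
  · exact eq_zero_of_sum_C_mul_X_sub_C_pow_eq_zero b (fun h => g (.inr h)) hB h

theorem polyFam_eq (k : ℕ) :
    polyFam k = Sum.elim (fun h : Fin (k + 2) => (X - C Complex.I) ^ (k + 2 + (h : ℕ)))
      (fun h : Fin (k + 2) => (X - C (-Complex.I)) ^ (k + 2 + (h : ℕ))) := by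
  simp only [polyFam, C_neg, sub_neg_eq_add, add_right_comm]

theorem polyFam_mem_degreeLT (k : ℕ) (j : Fin (k + 2) ⊕ Fin (k + 2)) :
    polyFam k j ∈ degreeLT ℂ (2 * k + 4) := by
  rw [mem_degreeLT, polyFam_eq]
  rcases j with h | h <;>
  · simp only [Sum.elim_inl, Sum.elim_inr, degree_pow, degree_X_sub_C, nsmul_one]
    have := h.2
    exact_mod_cast (by lia : k + 2 + (h : ℕ) < 2 * k + 4)

theorem statement17 (k : ℕ) :
    LinearIndependent ℂ (polyFam k) ∧
    Submodule.span ℂ (Set.range (polyFam k)) = Polynomial.degreeLT ℂ (2 * k + 4) := by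
  have hli : LinearIndependent ℂ (polyFam k) := by
    rw [polyFam_eq]
    exact linearIndependent_X_sub_C_pow_sumElim (self_ne_neg.2 Complex.I_ne_zero) (k + 2)
  have : Module.Finite ℂ (degreeLT ℂ (2 * k + 4)) :=
    Module.Finite.equiv (degreeLTEquiv ℂ (2 * k + 4)).symm
  refine ⟨hli, Submodule.eq_of_le_of_finrank_eq ?_ ?_⟩
  · rw [Submodule.span_le]
    rintro _ ⟨j, rfl⟩
    exact polyFam_mem_degreeLT k j
  · rw [finrank_span_eq_card hli, (degreeLTEquiv ℂ (2 * k + 4)).finrank_eq]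
    simp only [Fintype.card_sum, Fintype.card_fin, Module.finrank_fin_fun]
    lia
end

section
/- Let $\mathfrak{g}_0$ be a Lie algebra over $\mathbb{R}$, $\mathfrak{h}_0$ an $\mathbb{R}$-linear subspace of $\mathfrak{g}_0$, and $X\in\mathfrak{g}_0$ an element such that $(\mathrm{ad}\,Y)^h(X)\in\mathfrak{h}_0$ for every $Y\in\mathfrak{g}_0$ and every integer $h\ge 0$. Then $\mathrm{ad}(Y_1)\circ\cdots\circ\mathrm{ad}(Y_h)(X)\in\mathfrak{h}_0$ for every $h\ge 1$ and all $Y_1,\dots,Y_h\in\mathfrak{g}_0$. -/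
/-- A symmetric multilinear map over a field of characteristic zero that vanishes on the diagonal
is zero. -/
theorem MultilinearMap.eq_zero_of_symm_of_diag_eq_zero {K M N ι : Type*} [Field K] [CharZero K]
    [AddCommGroup M] [Module K M] [AddCommGroup N] [Module K N] [Fintype ι]
    (f : MultilinearMap K (fun _ : ι => M) N)
    (hsymm : ∀ (σ : Equiv.Perm ι) (v : ι → M), f (v ∘ σ) = f v)
    (hdiag : ∀ y : M, f (fun _ => y) = 0) (v : ι → M) : f v = 0 := by
  classical
  have hcoeff (r : ι → ι) :
      (∑ S : Finset ι, if ∀ i, r i ∈ S then (-1 : K) ^ S.card else 0) =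
        if Function.Surjective r then (-1 : K) ^ Fintype.card ι else 0 := by
    have h := Finset.prod_add (fun _ : ι => (-1 : K))
      (fun j => if j ∈ Set.range r then (0 : K) else 1) Finset.univ
    rw [Finset.powerset_univ] at h
    trans ∏ j : ι, ((-1 : K) + if j ∈ Set.range r then (0 : K) else 1)
    · rw [h]
      refine Finset.sum_congr rfl fun S _ => ?_
      rw [Finset.prod_const]
      split_ifs with hS
      · rw [Finset.prod_eq_one, mul_one]
        intro j hj
        rw [if_neg]
        rintro ⟨i, rfl⟩
        exact (Finset.mem_sdiff.1 hj).2 (hS i)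
      · push Not at hS
        obtain ⟨i, hi⟩ := hS
        rw [Finset.prod_eq_zero (i := r i), mul_zero]
        · simpa using hi
        · simp
    · split_ifs with hr
      · rw [Finset.prod_congr rfl (g := fun _ => (-1 : K))]
        · simp
        · intro j _
          rw [if_pos (Set.mem_range.2 (hr j)), add_zero]
      · simp only [Function.Surjective, not_forall] at hr
        obtain ⟨j, hj⟩ := hr
        refine Finset.prod_eq_zero (Finset.mem_univ j) ?_
        rw [if_neg (by simpa using hj)]
        ring
  have hexpand (S : Finset ι) :
      (∑ r : ι → ι, (if ∀ i, r i ∈ S then (-1 : K) ^ S.card else 0) • f (v ∘ r)) = 0 := by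
    have h := f.map_sum_finset (fun _ j => v j) (fun _ => S)
    rw [hdiag] at h
    simp only [ite_smul, zero_smul]
    rw [← Finset.sum_filter, ← Finset.smul_sum]
    have hS : (Finset.univ.filter fun r : ι → ι => ∀ i, r i ∈ S) =
        Fintype.piFinset fun _ => S := by
      ext r
      simp
    rw [hS]
    exact (congrArg _ h.symm).trans (smul_zero _)
  have hsum : ∑ r : ι → ι,
      (if Function.Surjective r then (-1 : K) ^ Fintype.card ι else 0) • f (v ∘ r) = 0 := by
    simp only [← hcoeff, Finset.sum_smul]
    rw [Finset.sum_comm]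
    exact Finset.sum_eq_zero fun S _ => hexpand S
  simp only [ite_smul, zero_smul] at hsum
  rw [← Finset.sum_filter, Finset.sum_congr rfl (g := fun _ => (-1 : K) ^ Fintype.card ι • f v),
    Finset.sum_const, ← Nat.cast_smul_eq_nsmul K, smul_smul] at hsum
  · refine (smul_eq_zero.1 hsum).resolve_left (mul_ne_zero ?_ (by simp))
    rw [Nat.cast_ne_zero]
    exact Finset.card_ne_zero_of_mem (a := id) (by simp [Function.surjective_id])
  · intro r hr
    have hr' : Function.Bijective r := Finite.surjective_iff_bijective.1 (Finset.mem_filter.1 hr).2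
    rw [← hsymm (Equiv.ofBijective r hr') v, Equiv.coe_ofBijective]

section IteratedBracket

variable {G : Type*} [LieRing G] [LieAlgebra ℝ G]

theorem foldr_lie_eq_prod_ad (l : List G) (Z : G) :
    l.foldr (fun y a => ⁅y, a⁆) Z = (l.map (LieAlgebra.ad ℝ G)).prod Z := by
  induction l with
  | nil => simp
  | cons a l ih => simp [ih]

/-- If `N` contains all shorter iterated brackets applied to `X`, then reordering the entries of an
iterated bracket changes its value on `X` only by an element of `N`. -/
theorem foldr_lie_sub_mem_of_perm {N : Submodule ℝ G} {X : G} {n : ℕ}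
    (hN : ∀ l : List G, l.length < n → l.foldr (fun y a => ⁅y, a⁆) X ∈ N)
    {l₁ l₂ : List G} (h : l₁.Perm l₂) (p : List G) (hp : (p ++ l₁).length = n) :
    (p ++ l₁).foldr (fun y a => ⁅y, a⁆) X - (p ++ l₂).foldr (fun y a => ⁅y, a⁆) X ∈ N := by
  induction h generalizing p with
  | nil => simp
  | cons a _ ih => simpa using ih (p ++ [a]) (by simpa using hp)
  | swap x y l =>
    have h := hN (p ++ ⁅y, x⁆ :: l) (by simp at hp ⊢; omega)
    rw [List.foldr_append, List.foldr_cons, lie_lie, foldr_lie_eq_prod_ad, map_sub] at h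
    simpa only [List.foldr_append, List.foldr_cons, foldr_lie_eq_prod_ad p] using h
  | trans h₁ _ ih₁ ih₂ =>
    have h := N.add_mem (ih₁ p hp) (ih₂ p (by simpa [h₁.length_eq] using hp))
    simpa using h

theorem foldr_lie_mem {N : Submodule ℝ G} {X : G}
    (hX : ∀ Y : G, ∀ h : ℕ, (fun Z => ⁅Y, Z⁆)^[h] X ∈ N) (n : ℕ) :
    ∀ l : List G, l.length = n → l.foldr (fun y a => ⁅y, a⁆) X ∈ N := by
  induction n using Nat.strong_induction_on with
  | h n ih =>
    let f : MultilinearMap ℝ (fun _ : Fin n => G) (G ⧸ N) :=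
      (N.mkQ ∘ₗ LinearMap.applyₗ X).compMultilinearMap
        ((MultilinearMap.mkPiAlgebraFin ℝ n (Module.End ℝ G)).compLinearMap
          fun _ => (LieAlgebra.ad ℝ G : G →ₗ[ℝ] Module.End ℝ G))
    have hf (v : Fin n → G) : f v = N.mkQ ((List.ofFn v).foldr (fun y a => ⁅y, a⁆) X) := by
      rw [foldr_lie_eq_prod_ad, List.map_ofFn]
      simp [f, Function.comp_def]
    have hzero := f.eq_zero_of_symm_of_diag_eq_zero
      (fun σ v => by
        rw [hf, hf, ← sub_eq_zero, ← map_sub, Submodule.mkQ_apply, Submodule.Quotient.mk_eq_zero]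
        exact foldr_lie_sub_mem_of_perm (fun l hl => ih _ hl l rfl)
          (Equiv.Perm.ofFn_comp_perm σ v) [] (by simp))
      (fun y => by
        rw [hf, Submodule.mkQ_apply, Submodule.Quotient.mk_eq_zero, List.ofFn_const]
        convert hX y n using 1
        clear hf f ih
        induction n with
        | zero => simp
        | succ n ih => rw [List.replicate_succ, List.foldr_cons, ih, Function.iterate_succ_apply'])
    rintro l rfl
    have h := hzero l.get
    rwa [hf, Submodule.mkQ_apply, Submodule.Quotient.mk_eq_zero, List.ofFn_get] at h

end IteratedBracket


theorem statement19 {G : Type*} [LieRing G] [LieAlgebra ℝ G]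
    (h₀ : Submodule ℝ G) (X : G)
    (hX : ∀ Y : G, ∀ h : ℕ, (fun Z => ⁅Y, Z⁆)^[h] X ∈ h₀) :
    ∀ h : ℕ, 1 ≤ h → ∀ Y : Fin h → G,
      (List.ofFn Y).foldr (fun y a => ⁅y, a⁆) X ∈ h₀ := by
  intro h _ Y
  exact foldr_lie_mem hX h _ (List.length_ofFn)
end
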